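/- arXiv:1503.04482 — 5 statements merged into one kernel-verified Lean document; each statement's English description precedes it below -/
import Mathlib

section
/- Let L0 and L1 be real symmetric n×n matrices and set L(t) := cos(t)·L0 + sin(t)·L1. Then the identity (L(t)^4 − (10/3)·L(t)^2 + I)·L(t) = 0 holds for all t ∈ ℝ if and only if the three matrix equations L_+·P_4 = 0, L_+·P_2 + L_−·P_4 = 0, and L_+·P_0 + L_−·P_2 = 0 hold. -/
open Matrix

noncomputable section

/-- `L₊ = ½(L0 - i·L1)`, viewed as a complex matrix. -/
def Lplus {n : ℕ} (L0 L1 : Matrix (Fin n) (Fin n) ℝ) : Matrix (Fin n) (Fin n) ℂ :=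
  (1 / 2 : ℂ) • (L0.map Complex.ofReal - Complex.I • L1.map Complex.ofReal)

/-- `L₋ = ½(L0 + i·L1)`, viewed as a complex matrix. -/
def Lminus {n : ℕ} (L0 L1 : Matrix (Fin n) (Fin n) ℝ) : Matrix (Fin n) (Fin n) ℂ :=
  (1 / 2 : ℂ) • (L0.map Complex.ofReal + Complex.I • L1.map Complex.ofReal)

/-- `σ(A³B)`: the average of all words consisting of three factors `A` and one factor `B`. -/
def word31 {n : ℕ} (A B : Matrix (Fin n) (Fin n) ℂ) : Matrix (Fin n) (Fin n) ℂ :=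
  (1 / 4 : ℂ) • (A ^ 3 * B + A ^ 2 * B * A + A * B * A ^ 2 + B * A ^ 3)

/-- `σ(A²B²)`: the average of all words consisting of two factors `A` and two factors `B`. -/
def word22 {n : ℕ} (A B : Matrix (Fin n) (Fin n) ℂ) : Matrix (Fin n) (Fin n) ℂ :=
  (1 / 6 : ℂ) •
    (A * A * B * B + A * B * A * B + A * B * B * A + B * A * A * B + B * A * B * A +
      B * B * A * A)

/-- `σ(AB)`: the average of the two words consisting of one factor `A` and one factor `B`. -/
def word11 {n : ℕ} (A B : Matrix (Fin n) (Fin n) ℂ) : Matrix (Fin n) (Fin n) ℂ :=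
  (1 / 2 : ℂ) • (A * B + B * A)

/-- `P₄ := L₊⁴`. -/
def Pfour {n : ℕ} (L0 L1 : Matrix (Fin n) (Fin n) ℝ) : Matrix (Fin n) (Fin n) ℂ :=
  Lplus L0 L1 ^ 4

/-- `P₂ := 4·σ(L₊³L₋) - (10/3)·L₊²`. -/
def Ptwo {n : ℕ} (L0 L1 : Matrix (Fin n) (Fin n) ℝ) : Matrix (Fin n) (Fin n) ℂ :=
  (4 : ℂ) • word31 (Lplus L0 L1) (Lminus L0 L1) - (10 / 3 : ℂ) • Lplus L0 L1 ^ 2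

/-- `P₀ := 6·σ(L₊²L₋²) - (20/3)·σ(L₊L₋) + 1`. -/
def Pzero {n : ℕ} (L0 L1 : Matrix (Fin n) (Fin n) ℝ) : Matrix (Fin n) (Fin n) ℂ :=
  (6 : ℂ) • word22 (Lplus L0 L1) (Lminus L0 L1) -
    (20 / 3 : ℂ) • word11 (Lplus L0 L1) (Lminus L0 L1) + 1

/-- The coefficients of a trigonometric sum `∑ zᵏ aₖ` vanish if the sum vanishes on the circle. -/
lemma coeffs_eq_zero_of_circle (a b c d e f : ℂ)
    (h : ∀ t : ℝ, Complex.exp (t * Complex.I) ^ 10 * a + Complex.exp (t * Complex.I) ^ 8 * b +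
      Complex.exp (t * Complex.I) ^ 6 * c + Complex.exp (t * Complex.I) ^ 4 * d +
      Complex.exp (t * Complex.I) ^ 2 * e + f = 0) :
    a = 0 ∧ b = 0 ∧ c = 0 := by
  open Polynomial in
  let p : ℂ[X] := X ^ 10 * C a + X ^ 8 * C b + X ^ 6 * C c + X ^ 4 * C d + X ^ 2 * C e + C f
  have hp : p = 0 := by
    apply Polynomial.eq_zero_of_infinite_isRoot
    have hinf : (Set.range fun x : Circle => (x : ℂ)).Infinite := by
      have : Infinite Circle := by
        refine Set.infinite_univ_iff.mp ?_
        refine Set.infinite_of_injOn_mapsTo (f := Circle.exp) (s := Set.Ioc (-Real.pi) Real.pi)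
          ?_ (fun _ _ => Set.mem_univ _) (Set.Ioc_infinite (by linarith [Real.pi_pos]))
        intro x hx y hy hxy
        rw [← Circle.arg_exp hx.1 hx.2, ← Circle.arg_exp hy.1 hy.2, hxy]
      exact Set.infinite_range_of_injective Circle.coe_injective
    refine hinf.mono ?_
    rintro _ ⟨x, rfl⟩
    have hx := h (Complex.arg x)
    rw [← Circle.coe_exp, Circle.exp_arg] at hx
    simp only [p, Polynomial.IsRoot, Polynomial.eval_add, Polynomial.eval_mul,
      Polynomial.eval_pow, Polynomial.eval_X, Polynomial.eval_C]
    exact hx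
  refine ⟨?_, ?_, ?_⟩
  · simpa [p, Polynomial.coeff_X_pow, Polynomial.coeff_C] using congrArg (fun q => q.coeff 10) hp
  · simpa [p, Polynomial.coeff_X_pow, Polynomial.coeff_C] using congrArg (fun q => q.coeff 8) hp
  · simpa [p, Polynomial.coeff_X_pow, Polynomial.coeff_C] using congrArg (fun q => q.coeff 6) hp

section

variable {n : ℕ}

lemma smul_add_smul_sq (A B : Matrix (Fin n) (Fin n) ℂ) {z w : ℂ} (hzw : z * w = 1) :
    (z • A + w • B) ^ 2 = z ^ 2 • A ^ 2 + (2 : ℂ) • word11 A B + w ^ 2 • B ^ 2 := by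
  have : (z • A + w • B) ^ 2 =
      z ^ 2 • A ^ 2 + (z * w) • (2 : ℂ) • word11 A B + w ^ 2 • B ^ 2 := by
    simp only [word11, pow_two, mul_add, add_mul, smul_mul_assoc, mul_smul_comm]
    module
  rw [this, hzw, one_smul]

lemma smul_add_smul_pow_four (A B : Matrix (Fin n) (Fin n) ℂ) {z w : ℂ} (hzw : z * w = 1) :
    (z • A + w • B) ^ 4 = z ^ 4 • A ^ 4 + z ^ 2 • (4 : ℂ) • word31 A B + (6 : ℂ) • word22 A B +
      w ^ 2 • (4 : ℂ) • word31 B A + w ^ 4 • B ^ 4 := by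
  have : (z • A + w • B) ^ 4 = z ^ 4 • A ^ 4 + (z ^ 2 * (z * w)) • (4 : ℂ) • word31 A B +
      ((z * w) ^ 2) • (6 : ℂ) • word22 A B +
      (w ^ 2 * (z * w)) • (4 : ℂ) • word31 B A + w ^ 4 • B ^ 4 := by
    simp only [word31, word22, pow_succ, pow_zero, one_mul, mul_add, add_mul, smul_mul_assoc,
      mul_smul_comm, ← mul_assoc]
    module
  rw [this, hzw, one_pow, mul_one, mul_one, one_smul]

lemma word11_comm (A B : Matrix (Fin n) (Fin n) ℂ) : word11 A B = word11 B A := by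
  simp only [word11, add_comm]

lemma word22_comm (A B : Matrix (Fin n) (Fin n) ℂ) : word22 A B = word22 B A := by
  simp only [word22]
  module

/-- The Fourier expansion of the quintic in `zA + z⁻¹B`, multiplied by `z⁵`. -/
lemma pow_five_smul_quintic (A B : Matrix (Fin n) (Fin n) ℂ) {z w : ℂ} (hzw : z * w = 1) :
    z ^ 5 • (((z • A + w • B) ^ 4 - (10 / 3 : ℂ) • (z • A + w • B) ^ 2 + 1) * (z • A + w • B)) =
      z ^ 10 • (A * A ^ 4) +
      z ^ 8 • (A * ((4 : ℂ) • word31 A B - (10 / 3 : ℂ) • A ^ 2) + B * A ^ 4) +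
      z ^ 6 • (A * ((6 : ℂ) • word22 A B - (20 / 3 : ℂ) • word11 A B + 1) +
        B * ((4 : ℂ) • word31 A B - (10 / 3 : ℂ) • A ^ 2)) +
      z ^ 4 • (B * ((6 : ℂ) • word22 B A - (20 / 3 : ℂ) • word11 B A + 1) +
        A * ((4 : ℂ) • word31 B A - (10 / 3 : ℂ) • B ^ 2)) +
      z ^ 2 • (B * ((4 : ℂ) • word31 B A - (10 / 3 : ℂ) • B ^ 2) + A * B ^ 4) +
      B * B ^ 4 := by
  set L := z • A + w • B with hL
  have hcomm : (L ^ 4 - (10 / 3 : ℂ) • L ^ 2 + 1) * L =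
      L * (L ^ 4 - (10 / 3 : ℂ) • L ^ 2 + 1) := by
    simp only [add_mul, sub_mul, mul_add, mul_sub, smul_mul_assoc, mul_smul_comm, one_mul,
      mul_one, ← pow_succ, ← pow_succ']
  have hpoly : L ^ 4 - (10 / 3 : ℂ) • L ^ 2 + 1 =
      z ^ 4 • A ^ 4 + z ^ 2 • ((4 : ℂ) • word31 A B - (10 / 3 : ℂ) • A ^ 2) +
      ((6 : ℂ) • word22 A B - (20 / 3 : ℂ) • word11 A B + 1) +
      w ^ 2 • ((4 : ℂ) • word31 B A - (10 / 3 : ℂ) • B ^ 2) + w ^ 4 • B ^ 4 := by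
    rw [hL, smul_add_smul_sq A B hzw, smul_add_smul_pow_four A B hzw]
    module
  rw [hcomm, hpoly, word11_comm B A, word22_comm B A]
  generalize (4 : ℂ) • word31 A B - (10 / 3 : ℂ) • A ^ 2 = P
  generalize (4 : ℂ) • word31 B A - (10 / 3 : ℂ) • B ^ 2 = Q
  generalize (6 : ℂ) • word22 A B - (20 / 3 : ℂ) • word11 A B + 1 = R
  rw [hL]
  have hz : z ≠ 0 := left_ne_zero_of_mul_eq_one hzw
  obtain rfl : w = z⁻¹ := eq_inv_of_mul_eq_one_right hzw
  simp only [mul_add, add_mul, smul_mul_assoc, mul_smul_comm, smul_add, smul_smul]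
  match_scalars <;> field_simp

/-- The equation over `ℝ` is equivalent to its complexification, written through `L₊` and `L₋`. -/
lemma quintic_eq_zero_iff_complex (L0 L1 : Matrix (Fin n) (Fin n) ℝ) (t : ℝ) :
    ((Real.cos t • L0 + Real.sin t • L1) ^ 4 -
        (10 / 3 : ℝ) • (Real.cos t • L0 + Real.sin t • L1) ^ 2 + 1) *
      (Real.cos t • L0 + Real.sin t • L1) = 0 ↔
    ((Complex.exp (t * Complex.I) • Lplus L0 L1 +
          Complex.exp (-(t * Complex.I)) • Lminus L0 L1) ^ 4 -
        (10 / 3 : ℂ) • (Complex.exp (t * Complex.I) • Lplus L0 L1 +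
          Complex.exp (-(t * Complex.I)) • Lminus L0 L1) ^ 2 + 1) *
      (Complex.exp (t * Complex.I) • Lplus L0 L1 +
          Complex.exp (-(t * Complex.I)) • Lminus L0 L1) = 0 := by
  let φ := Complex.ofRealHom.mapMatrix (m := Fin n)
  have hφ : Function.Injective φ := Matrix.map_injective Complex.ofReal_injective
  have hsmul (c : ℝ) (M : Matrix (Fin n) (Fin n) ℝ) : φ (c • M) = (c : ℂ) • φ M := by
    ext i j
    simp [φ]
  have hL : φ (Real.cos t • L0 + Real.sin t • L1) = Complex.exp (t * Complex.I) • Lplus L0 L1 +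
      Complex.exp (-(t * Complex.I)) • Lminus L0 L1 := by
    ext i j
    rw [← neg_mul, Complex.exp_mul_I, Complex.exp_mul_I, Complex.cos_neg, Complex.sin_neg]
    simp [φ, Lplus, Lminus]
    linear_combination (Complex.sin t * (L1 i j : ℂ)) * Complex.I_sq
  rw [← hL, ← map_eq_zero_iff φ hφ]
  simp only [map_mul, map_add, map_sub, map_pow, map_one, hsmul]
  norm_num

/-- A conjugate-linear ring endomorphism, namely entrywise conjugation, swaps `L₊` and `L₋`. -/
lemma exists_conj_swap_Lplus_Lminus (L0 L1 : Matrix (Fin n) (Fin n) ℝ) :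
    ∃ φ : Matrix (Fin n) (Fin n) ℂ →+* Matrix (Fin n) (Fin n) ℂ,
      φ (Lplus L0 L1) = Lminus L0 L1 ∧ φ (Lminus L0 L1) = Lplus L0 L1 ∧
      ∀ (c : ℂ) (M : Matrix (Fin n) (Fin n) ℂ), φ (c • M) = star c • φ M := by
  refine ⟨(starRingEnd ℂ).mapMatrix, ?_, ?_, ?_⟩
  · ext i j
    simp [Lplus, Lminus, Complex.conj_ofNat]
  · ext i j
    simp [Lplus, Lminus, Complex.conj_ofNat]
    ring
  · intro c M
    ext i j
    simp

end

/-- the minimal polynomial equation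
`(L(t)⁴ - (10/3)·L(t)² + 1)·L(t) = 0` for all `t` is equivalent to the three matrix
equations `L₊·P₄ = 0`, `L₊·P₂ + L₋·P₄ = 0` and `L₊·P₀ + L₋·P₂ = 0`. -/
theorem statement1 (n : ℕ) (L0 L1 : Matrix (Fin n) (Fin n) ℝ)
    (h0 : L0.IsSymm) (h1 : L1.IsSymm) :
    (∀ t : ℝ,
      ((Real.cos t • L0 + Real.sin t • L1) ^ 4 -
          (10 / 3 : ℝ) • (Real.cos t • L0 + Real.sin t • L1) ^ 2 + 1) *
        (Real.cos t • L0 + Real.sin t • L1) = 0) ↔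
    (Lplus L0 L1 * Pfour L0 L1 = 0 ∧
     Lplus L0 L1 * Ptwo L0 L1 + Lminus L0 L1 * Pfour L0 L1 = 0 ∧
     Lplus L0 L1 * Pzero L0 L1 + Lminus L0 L1 * Ptwo L0 L1 = 0) := by
  set A := Lplus L0 L1 with hA
  set B := Lminus L0 L1 with hB
  simp only [quintic_eq_zero_iff_complex, Pfour, Ptwo, Pzero, ← hA, ← hB]
  have hzw (t : ℝ) : Complex.exp (t * Complex.I) * Complex.exp (-(t * Complex.I)) = 1 := by
    rw [← Complex.exp_add, add_neg_cancel, Complex.exp_zero]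
  constructor
  · intro h
    have key := fun t : ℝ => pow_five_smul_quintic A B (hzw t)
    simp only [h, smul_zero] at key
    have hij := fun i j => coeffs_eq_zero_of_circle _ _ _ _ _ _
      fun t => (congrFun (congrFun (key t) i) j).symm
    exact ⟨Matrix.ext fun i j => (hij i j).1, Matrix.ext fun i j => (hij i j).2.1,
      Matrix.ext fun i j => (hij i j).2.2⟩
  · rintro ⟨e5, e3, e1⟩ t
    obtain ⟨φ, hφA, hφB, hφ⟩ := exists_conj_swap_Lplus_Lminus L0 L1
    rw [← hA, ← hB] at hφA hφB
    have f5 := congrArg φ e5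
    have f3 := congrArg φ e3
    have f1 := congrArg φ e1
    simp only [word31, word22, word11, map_mul, map_add, map_sub, map_pow, map_one, map_zero, hφ,
      hφA, hφB, star_div₀, star_ofNat, star_one] at f5 f3 f1
    have key := pow_five_smul_quintic A B (hzw t)
    rw [e5, e3, e1] at key
    simp only [word31, word22, word11, f5, f3, f1, smul_zero, add_zero] at key
    exact (smul_eq_zero.mp key).resolve_left (pow_ne_zero _ (Complex.exp_ne_zero _))

end
end

section
/- Let L0 and L1 be real symmetric n×n matrices such that the three matrix equations L_+·P_4 = 0, L_+·P_2 + L_−·P_4 = 0, and L_+·P_0 + L_−·P_2 = 0 hold. Then P_i·L_+·P_j = 0 and P_i·L_−·P_j = 0 for all i, j ∈ {−4, −2, 0, 2, 4}. -/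
open Matrix

noncomputable section

/-- `P₋₂ :=` the complex conjugate of `P₂`. -/
def Pmtwo {n : ℕ} (L0 L1 : Matrix (Fin n) (Fin n) ℝ) : Matrix (Fin n) (Fin n) ℂ :=
  (Ptwo L0 L1).map (starRingEnd ℂ)

/-- `P₋₄ :=` the complex conjugate of `P₄`. -/
def Pmfour {n : ℕ} (L0 L1 : Matrix (Fin n) (Fin n) ℝ) : Matrix (Fin n) (Fin n) ℂ :=
  (Pfour L0 L1).map (starRingEnd ℂ)

/-- Sequences killed on both sides by the pencil `A + B` (in the graded sense) and vanishing in
high degrees annihilate both coefficients of the pencil. -/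
theorem mul_pencil_mul_eq_zero {R : Type*} [Ring R] {A B : R} {p : ℤ → R} {N : ℤ}
    (hl : ∀ i, A * p i + B * p (i + 1) = 0) (hr : ∀ i, p i * A + p (i + 1) * B = 0)
    (hN : ∀ i, N ≤ i → p i = 0) (i j : ℤ) : p i * A * p j = 0 ∧ p i * B * p j = 0 := by
  have key : ∀ m : ℕ, ∀ i j : ℤ, N ≤ i + m → p i * A * p j = 0 := by
    intro m
    induction m with
    | zero => intro i j h; simp [hN i (by simpa using h)]
    | succ m ih =>
      intro i j h
      have h1 := ih (i + 1) (j - 1) (by push_cast at h; lia)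
      have h2 := hl (j - 1)
      rw [sub_add_cancel] at h2
      rw [eq_neg_of_add_eq_zero_left (hr i), neg_mul, mul_assoc,
        eq_neg_of_add_eq_zero_right h2, mul_neg, neg_neg, ← mul_assoc, h1]
  have hA : ∀ i j : ℤ, p i * A * p j = 0 := fun i j => key (N - i).toNat i j (by lia)
  refine ⟨hA i j, ?_⟩
  have h := hr (i - 1)
  rw [sub_add_cancel] at h
  rw [eq_neg_of_add_eq_zero_right h, neg_mul, hA, neg_zero]

section Symmetry

variable {n : ℕ} {L0 L1 : Matrix (Fin n) (Fin n) ℝ}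

theorem Lplus_transpose (h0 : L0.IsSymm) (h1 : L1.IsSymm) : (Lplus L0 L1)ᵀ = Lplus L0 L1 := by
  ext i j
  simp [Lplus, h0.apply i j, h1.apply i j]

theorem Lminus_transpose (h0 : L0.IsSymm) (h1 : L1.IsSymm) :
    (Lminus L0 L1)ᵀ = Lminus L0 L1 := by
  ext i j
  simp [Lminus, h0.apply i j, h1.apply i j, mul_add]

theorem Lplus_conjTranspose (h0 : L0.IsSymm) (h1 : L1.IsSymm) :
    (Lplus L0 L1)ᴴ = Lminus L0 L1 := by
  ext i j
  simp [Lplus, Lminus, h0.apply i j, h1.apply i j]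

theorem Lminus_conjTranspose (h0 : L0.IsSymm) (h1 : L1.IsSymm) :
    (Lminus L0 L1)ᴴ = Lplus L0 L1 := by
  rw [← Lplus_conjTranspose h0 h1, conjTranspose_conjTranspose]

theorem Pfour_transpose (h0 : L0.IsSymm) (h1 : L1.IsSymm) : (Pfour L0 L1)ᵀ = Pfour L0 L1 := by
  simp [Pfour, transpose_pow, Lplus_transpose h0 h1]

theorem Ptwo_transpose (h0 : L0.IsSymm) (h1 : L1.IsSymm) : (Ptwo L0 L1)ᵀ = Ptwo L0 L1 := by
  simp only [Ptwo, word31, transpose_sub, transpose_smul, transpose_add, transpose_mul,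
    transpose_pow, Lplus_transpose h0 h1, Lminus_transpose h0 h1]
  noncomm_ring

theorem Pzero_transpose (h0 : L0.IsSymm) (h1 : L1.IsSymm) : (Pzero L0 L1)ᵀ = Pzero L0 L1 := by
  simp only [Pzero, word22, word11, transpose_sub, transpose_smul, transpose_add, transpose_mul,
    transpose_one, Lplus_transpose h0 h1, Lminus_transpose h0 h1]
  noncomm_ring

theorem Pzero_conjTranspose (h0 : L0.IsSymm) (h1 : L1.IsSymm) :
    (Pzero L0 L1)ᴴ = Pzero L0 L1 := by
  simp only [Pzero, word22, word11, conjTranspose_sub, conjTranspose_smul, conjTranspose_add,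
    conjTranspose_mul, conjTranspose_one, Lplus_conjTranspose h0 h1, Lminus_conjTranspose h0 h1,
    star_div₀, star_ofNat, star_one]
  noncomm_ring

theorem Ptwo_conjTranspose (h0 : L0.IsSymm) (h1 : L1.IsSymm) :
    (Ptwo L0 L1)ᴴ = Pmtwo L0 L1 := by
  rw [conjTranspose, Ptwo_transpose h0 h1]; rfl

theorem Pfour_conjTranspose (h0 : L0.IsSymm) (h1 : L1.IsSymm) :
    (Pfour L0 L1)ᴴ = Pmfour L0 L1 := by
  rw [conjTranspose, Pfour_transpose h0 h1]; rfl

theorem Pmtwo_transpose (h0 : L0.IsSymm) (h1 : L1.IsSymm) : (Pmtwo L0 L1)ᵀ = Pmtwo L0 L1 := by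
  rw [Pmtwo, ← transpose_map, Ptwo_transpose h0 h1]

theorem Pmfour_transpose (h0 : L0.IsSymm) (h1 : L1.IsSymm) :
    (Pmfour L0 L1)ᵀ = Pmfour L0 L1 := by
  rw [Pmfour, ← transpose_map, Pfour_transpose h0 h1]

end Symmetry

/-- The coefficients `P₂ₖ`, indexed by `k : ℤ` and extended by zero outside `-2 ≤ k ≤ 2`. -/
def Pcoeff {n : ℕ} (L0 L1 : Matrix (Fin n) (Fin n) ℝ) (k : ℤ) : Matrix (Fin n) (Fin n) ℂ :=
  if k = -2 then Pmfour L0 L1 else if k = -1 then Pmtwo L0 L1 else if k = 0 then Pzero L0 L1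
  else if k = 1 then Ptwo L0 L1 else if k = 2 then Pfour L0 L1 else 0

theorem Pcoeff_transpose {n : ℕ} {L0 L1 : Matrix (Fin n) (Fin n) ℝ}
    (h0 : L0.IsSymm) (h1 : L1.IsSymm) (k : ℤ) : (Pcoeff L0 L1 k)ᵀ = Pcoeff L0 L1 k := by
  unfold Pcoeff
  split_ifs <;> simp [Pmfour_transpose h0 h1, Pmtwo_transpose h0 h1, Pzero_transpose h0 h1,
    Ptwo_transpose h0 h1, Pfour_transpose h0 h1]

theorem Pcoeff_eq_zero {n : ℕ} (L0 L1 : Matrix (Fin n) (Fin n) ℝ) {k : ℤ}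
    (hk : k < -2 ∨ 2 < k) : Pcoeff L0 L1 k = 0 := by
  unfold Pcoeff
  split_ifs <;> first | rfl | lia

/-- if `L₊·P₄ = 0`, `L₊·P₂ + L₋·P₄ = 0` and `L₊·P₀ + L₋·P₂ = 0`, then
`Pᵢ·L₊·Pⱼ = 0` and `Pᵢ·L₋·Pⱼ = 0` for all `i, j ∈ {-4, -2, 0, 2, 4}`. -/
theorem statement2 (n : ℕ) (L0 L1 : Matrix (Fin n) (Fin n) ℝ)
    (h0 : L0.IsSymm) (h1 : L1.IsSymm)
    (e1 : Lplus L0 L1 * Pfour L0 L1 = 0)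
    (e2 : Lplus L0 L1 * Ptwo L0 L1 + Lminus L0 L1 * Pfour L0 L1 = 0)
    (e3 : Lplus L0 L1 * Pzero L0 L1 + Lminus L0 L1 * Ptwo L0 L1 = 0) :
    ∀ Pi ∈ ({Pmfour L0 L1, Pmtwo L0 L1, Pzero L0 L1, Ptwo L0 L1, Pfour L0 L1} :
        Set (Matrix (Fin n) (Fin n) ℂ)),
      ∀ Pj ∈ ({Pmfour L0 L1, Pmtwo L0 L1, Pzero L0 L1, Ptwo L0 L1, Pfour L0 L1} :
        Set (Matrix (Fin n) (Fin n) ℂ)),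
        Pi * Lplus L0 L1 * Pj = 0 ∧ Pi * Lminus L0 L1 * Pj = 0 := by
  have hA := Lplus_transpose h0 h1
  have hB := Lminus_transpose h0 h1
  have e4 : Lplus L0 L1 * Pmtwo L0 L1 + Lminus L0 L1 * Pzero L0 L1 = 0 := by
    have h := congrArg (fun M => Mᴴᵀ) e3
    simpa [Lplus_conjTranspose h0 h1, Lminus_conjTranspose h0 h1, Pzero_conjTranspose h0 h1,
      Ptwo_conjTranspose h0 h1, Pzero_transpose h0 h1, Pmtwo_transpose h0 h1, hA, hB,
      add_comm] using h
  have e5 : Lplus L0 L1 * Pmfour L0 L1 + Lminus L0 L1 * Pmtwo L0 L1 = 0 := by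
    have h := congrArg (fun M => Mᴴᵀ) e2
    simpa [Lplus_conjTranspose h0 h1, Lminus_conjTranspose h0 h1, Pfour_conjTranspose h0 h1,
      Ptwo_conjTranspose h0 h1, Pmfour_transpose h0 h1, Pmtwo_transpose h0 h1, hA, hB,
      add_comm] using h
  have e6 : Lminus L0 L1 * Pmfour L0 L1 = 0 := by
    have h := congrArg (fun M => Mᴴᵀ) e1
    simpa [Lplus_conjTranspose h0 h1, Pfour_conjTranspose h0 h1, Pmfour_transpose h0 h1, hB]
      using h
  have hl : ∀ k, Lplus L0 L1 * Pcoeff L0 L1 k + Lminus L0 L1 * Pcoeff L0 L1 (k + 1) = 0 := by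
    intro k
    by_cases hk : k < -3 ∨ 2 < k
    · rw [Pcoeff_eq_zero L0 L1 (by lia), Pcoeff_eq_zero L0 L1 (by lia)]
      simp
    · obtain ⟨hk1, hk2⟩ : -3 ≤ k ∧ k ≤ 2 := by lia
      interval_cases k <;> simp [Pcoeff, e1, e2, e3, e4, e5, e6]
  have hr : ∀ k, Pcoeff L0 L1 k * Lplus L0 L1 + Pcoeff L0 L1 (k + 1) * Lminus L0 L1 = 0 := by
    intro k
    simpa [hA, hB, Pcoeff_transpose h0 h1] using congrArg transpose (hl k)
  have hmem : ∀ M ∈ ({Pmfour L0 L1, Pmtwo L0 L1, Pzero L0 L1, Ptwo L0 L1, Pfour L0 L1} :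
      Set (Matrix (Fin n) (Fin n) ℂ)), ∃ k, Pcoeff L0 L1 k = M := by
    rintro M (rfl | rfl | rfl | rfl | rfl)
    exacts [⟨-2, by simp [Pcoeff]⟩, ⟨-1, by simp [Pcoeff]⟩, ⟨0, by simp [Pcoeff]⟩,
      ⟨1, by simp [Pcoeff]⟩, ⟨2, by simp [Pcoeff]⟩]
  intro Pi hPi Pj hPj
  obtain ⟨i, rfl⟩ := hmem Pi hPi
  obtain ⟨j, rfl⟩ := hmem Pj hPj
  exact mul_pencil_mul_eq_zero hl hr (N := 3) (fun k hk => Pcoeff_eq_zero L0 L1 (by lia)) i j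

end
end

section
/- Let m be a positive integer, let L0 and L1 be real symmetric 5m×5m matrices such that for every t ∈ ℝ the matrix L(t) := cos(t)·L0 + sin(t)·L1 has eigenvalues exactly −√3, −1/√3, 0, 1/√3, √3, each with multiplicity m, and set P(t) := L(t)^4 − (10/3)·L(t)^2 + I. Then: (a) the complex span of the union over t ∈ ℝ of the column spaces of P(t) (regarded as complex matrices) equals the sum of the ranges of P_4, P_2, P_0, P_{−2}, P_{−4}; (b) the real dimension of E satisfies dim E ≤ 3m. -/
open Matrix

noncomputable section

/-- The family `L(t) = cos(t)·L0 + sin(t)·L1`. -/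
def Lfam {n : ℕ} (L0 L1 : Matrix (Fin n) (Fin n) ℝ) (t : ℝ) : Matrix (Fin n) (Fin n) ℝ :=
  Real.cos t • L0 + Real.sin t • L1

/-- `P(t) = L(t)⁴ - (10/3)·L(t)² + 1`. -/
def Pfam {n : ℕ} (L0 L1 : Matrix (Fin n) (Fin n) ℝ) (t : ℝ) : Matrix (Fin n) (Fin n) ℝ :=
  Lfam L0 L1 t ^ 4 - (10 / 3 : ℝ) • Lfam L0 L1 t ^ 2 + 1


/-- If infinitely many values of a vector-valued polynomial lie in a subspace, so do its
coefficients. -/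
lemma coeff_mem_of_infinite {K V : Type*} [Field K] [AddCommGroup V] [Module K V]
    (S : Submodule K V) {s : Set K} (hs : s.Infinite) {n : ℕ} (p : Fin n → V)
    (h : ∀ w ∈ s, ∑ k : Fin n, w ^ (k : ℕ) • p k ∈ S) (k : Fin n) : p k ∈ S := by
  let w : Fin n → K := fun j => hs.natEmbedding s j
  have hw : Function.Injective w := fun a b hab =>
    Fin.ext ((hs.natEmbedding s).injective (Subtype.ext hab))
  have hu : IsUnit (vandermonde w).det := (det_vandermonde_ne_zero_iff.2 hw).isUnit
  have key : p k = ∑ j, (vandermonde w)⁻¹ k j • ∑ l : Fin n, w j ^ (l : ℕ) • p l := by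
    simp_rw [Finset.smul_sum, smul_smul]
    rw [Finset.sum_comm]
    simp_rw [← Finset.sum_smul]
    have : ∀ l : Fin n, ∑ j, (vandermonde w)⁻¹ k j * w j ^ (l : ℕ) =
        (1 : Matrix (Fin n) (Fin n) K) k l := by
      intro l
      rw [← nonsing_inv_mul _ hu, mul_apply]
      simp [vandermonde_apply]
    simp [this, one_apply]
  rw [key]
  exact S.sum_mem fun j _ => S.smul_mem _ (h _ (hs.natEmbedding s j).2)

lemma infinite_exp_mul_I : (Set.range fun θ : ℝ => Complex.exp (θ * Complex.I)).Infinite := by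
  refine Set.Infinite.mono (s := (fun θ : ℝ => Complex.exp (θ * Complex.I)) '' Set.Ioo 0 1)
    (Set.image_subset_range _ _) (Set.Infinite.image ?_ (Set.Ioo_infinite one_pos))
  intro a ha b hb hab
  have hπ := Real.pi_gt_three
  have e := congrArg Complex.arg hab
  simp only at e
  rwa [Complex.arg_exp_mul_I, Complex.arg_exp_mul_I, toIocMod_eq_self _ |>.2,
    toIocMod_eq_self _ |>.2] at e <;> constructor <;> linarith [ha.1, ha.2, hb.1, hb.2]

section Fourier

variable {n : ℕ} (L0 L1 : Matrix (Fin n) (Fin n) ℝ)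

lemma Lplus_map_conj : (Lplus L0 L1).map (starRingEnd ℂ) = Lminus L0 L1 := by
  ext i j
  simp [Lplus, Lminus, map_ofNat]

lemma Lminus_map_conj : (Lminus L0 L1).map (starRingEnd ℂ) = Lplus L0 L1 := by
  ext i j
  simp [Lplus, Lminus, map_ofNat]
  ring

lemma Pmfour_eq : Pmfour L0 L1 = Lminus L0 L1 ^ 4 := by
  rw [Pmfour, Pfour, Matrix.map_pow, Lplus_map_conj]

lemma Pmtwo_eq : Pmtwo L0 L1 =
    (4 : ℂ) • word31 (Lminus L0 L1) (Lplus L0 L1) - (10 / 3 : ℂ) • Lminus L0 L1 ^ 2 := by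
  have h : ∀ (c : ℂ) (M : Matrix (Fin n) (Fin n) ℂ),
      (c • M).map (starRingEnd ℂ) = (starRingEnd ℂ c) • M.map (starRingEnd ℂ) := by
    intro c M; ext; simp
  simp [Pmtwo, Ptwo, word31, h, Matrix.map_pow, Matrix.map_mul, Matrix.map_add, Matrix.map_sub,
    Lplus_map_conj, Lminus_map_conj, map_ofNat]

lemma Lfam_map (t : ℝ) : (Lfam L0 L1 t).map Complex.ofReal =
    Complex.exp (t * Complex.I) • Lplus L0 L1 + (Complex.exp (t * Complex.I))⁻¹ • Lminus L0 L1 := by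
  ext i j
  rw [← Complex.exp_neg, ← neg_mul, Complex.exp_mul_I, Complex.exp_mul_I, Complex.cos_neg,
    Complex.sin_neg]
  simp [Lfam, Lplus, Lminus]
  linear_combination Complex.sin t * L1 i j * Complex.I_sq

/-- The Fourier expansion of the family `P(t)`. -/
lemma Pfam_map (t : ℝ) : (Pfam L0 L1 t).map Complex.ofReal =
    ((Complex.exp (t * Complex.I))⁻¹ ^ 4) •
      (Pmfour L0 L1 + Complex.exp (t * Complex.I) ^ 2 • Pmtwo L0 L1 +
        Complex.exp (t * Complex.I) ^ 4 • Pzero L0 L1 +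
        Complex.exp (t * Complex.I) ^ 6 • Ptwo L0 L1 +
        Complex.exp (t * Complex.I) ^ 8 • Pfour L0 L1) := by
  have h : (Pfam L0 L1 t).map Complex.ofReal = (Lfam L0 L1 t).map Complex.ofReal ^ 4 -
      (10 / 3 : ℂ) • (Lfam L0 L1 t).map Complex.ofReal ^ 2 + 1 := by
    have e : ∀ k, (Lfam L0 L1 t).map Complex.ofReal ^ k =
        (Lfam L0 L1 t ^ k).map Complex.ofReal := fun k =>
      (Matrix.map_pow (Lfam L0 L1 t) Complex.ofRealHom k).symm
    rw [e, e, Pfam]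
    ext i j
    simp [one_apply, apply_ite Complex.ofReal]
  rw [h, Lfam_map, Pmfour_eq, Pmtwo_eq, Ptwo, Pfour, Pzero, word31, word31, word22, word11]
  have hz := Complex.exp_ne_zero (t * Complex.I)
  generalize Complex.exp (t * Complex.I) = z at hz
  generalize Lplus L0 L1 = A
  generalize Lminus L0 L1 = B
  simp only [pow_succ, pow_zero, one_mul, mul_add, add_mul, smul_mul_assoc, mul_smul_comm,
    smul_add, smul_smul, ← mul_assoc]
  match_scalars <;> field_simp <;> norm_num

/-- The span of the column spaces of the `P(t)` is the sum of the ranges of the Fourier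
coefficients. -/
lemma iSup_range_Pfam :
    (⨆ t : ℝ, LinearMap.range ((Pfam L0 L1 t).map Complex.ofReal).mulVecLin) =
      LinearMap.range (Pfour L0 L1).mulVecLin ⊔ LinearMap.range (Ptwo L0 L1).mulVecLin ⊔
        LinearMap.range (Pzero L0 L1).mulVecLin ⊔ LinearMap.range (Pmtwo L0 L1).mulVecLin ⊔
        LinearMap.range (Pmfour L0 L1).mulVecLin := by
  apply le_antisymm
  · refine iSup_le fun t => ?_
    rintro _ ⟨x, rfl⟩
    simp only [mulVecLin_apply, Pfam_map, smul_mulVec, add_mulVec]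
    have h4 : Pfour L0 L1 *ᵥ x ∈ LinearMap.range (Pfour L0 L1).mulVecLin := ⟨x, rfl⟩
    have h2 : Ptwo L0 L1 *ᵥ x ∈ LinearMap.range (Ptwo L0 L1).mulVecLin := ⟨x, rfl⟩
    have h0 : Pzero L0 L1 *ᵥ x ∈ LinearMap.range (Pzero L0 L1).mulVecLin := ⟨x, rfl⟩
    have h2' : Pmtwo L0 L1 *ᵥ x ∈ LinearMap.range (Pmtwo L0 L1).mulVecLin := ⟨x, rfl⟩
    have h4' : Pmfour L0 L1 *ᵥ x ∈ LinearMap.range (Pmfour L0 L1).mulVecLin := ⟨x, rfl⟩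
    rw [show ∀ a b c d e : Fin n → ℂ, a + b + c + d + e = e + d + c + b + a by
      intros; abel]
    refine Submodule.smul_mem _ _ (Submodule.add_mem_sup (Submodule.add_mem_sup
      (Submodule.add_mem_sup (Submodule.add_mem_sup ?_ ?_) ?_) ?_) h4') <;>
    exact Submodule.smul_mem _ _ ‹_›
  · have key : ∀ (x : Fin n → ℂ) (k : Fin 5),
        (![Pmfour L0 L1 *ᵥ x, Pmtwo L0 L1 *ᵥ x, Pzero L0 L1 *ᵥ x, Ptwo L0 L1 *ᵥ x,
          Pfour L0 L1 *ᵥ x] : Fin 5 → Fin n → ℂ) k ∈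
        ⨆ t : ℝ, LinearMap.range ((Pfam L0 L1 t).map Complex.ofReal).mulVecLin := by
      intro x
      refine coeff_mem_of_infinite _ infinite_exp_mul_I _ ?_
      rintro _ ⟨θ, rfl⟩
      have hmem := Submodule.mem_iSup_of_mem
        (p := fun t : ℝ => LinearMap.range ((Pfam L0 L1 t).map Complex.ofReal).mulVecLin)
        (θ / 2) ⟨x, rfl⟩
      have hz : Complex.exp (θ * Complex.I) =
          Complex.exp ((θ / 2 : ℝ) * Complex.I) ^ 2 := by
        rw [← Complex.exp_nat_mul]; congr 1; push_cast; ring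
      have hne := Complex.exp_ne_zero ((θ / 2 : ℝ) * Complex.I)
      rw [mulVecLin_apply, Pfam_map, smul_mulVec,
        Submodule.smul_mem_iff _ (pow_ne_zero _ (inv_ne_zero hne))] at hmem
      convert hmem using 1
      simp only [hz, Fin.sum_univ_five, add_mulVec, smul_mulVec, ← pow_mul]
      simp
    refine sup_le (sup_le (sup_le (sup_le ?_ ?_) ?_) ?_) ?_ <;> rintro _ ⟨x, rfl⟩
    exacts [key x 4, key x 3, key x 2, key x 1, key x 0]

end Fourier

lemma eq_zero_of_isSymm_of_pow_eq_zero {n : ℕ} {N : Matrix (Fin n) (Fin n) ℝ} (hN : N.IsSymm)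
    {k : ℕ} (h : N ^ k = 0) : N = 0 := by
  induction k with
  | zero => rw [← mul_one N, ← pow_zero N, h, mul_zero]
  | succ k ih =>
    rcases k with _ | k
    · simpa using h
    · apply ih
      rw [← conjTranspose_mul_self_eq_zero, conjTranspose_eq_transpose_of_trivial, transpose_pow,
        hN.eq, ← pow_add, show k + 1 + (k + 1) = k + (k + 1 + 1) by ring, pow_add, h, mul_zero]

lemma isSymm_pow {n : ℕ} {N : Matrix (Fin n) (Fin n) ℝ} (hN : N.IsSymm) (k : ℕ) :
    (N ^ k).IsSymm := by
  rw [IsSymm, transpose_pow, hN.eq]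

section Kernel

variable {n : ℕ} {L0 L1 : Matrix (Fin n) (Fin n) ℝ}

lemma isSymm_Lfam (h0 : L0.IsSymm) (h1 : L1.IsSymm) (t : ℝ) : (Lfam L0 L1 t).IsSymm :=
  (h0.smul _).add (h1.smul _)

lemma isSymm_Pfam (h0 : L0.IsSymm) (h1 : L1.IsSymm) (t : ℝ) : (Pfam L0 L1 t).IsSymm :=
  have h := isSymm_Lfam h0 h1 t
  ((isSymm_pow h 4).sub ((isSymm_pow h 2).smul _)).add isSymm_one

/-- A symmetric matrix is annihilated by the radical of its characteristic polynomial. -/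
lemma Lfam_mul_Pfam (h0 : L0.IsSymm) (h1 : L1.IsSymm) {m : ℕ} {t : ℝ}
    (hiso : (Lfam L0 L1 t).charpoly =
      (Polynomial.X ^ 2 - Polynomial.C 3) ^ m *
        (Polynomial.X ^ 2 - Polynomial.C (1 / 3 : ℝ)) ^ m * Polynomial.X ^ m) :
    Lfam L0 L1 t * Pfam L0 L1 t = 0 := by
  have hcomm : Commute (Lfam L0 L1 t) (Pfam L0 L1 t) :=
    (((Commute.refl _).pow_right 4).sub_right (((Commute.refl _).pow_right 2).smul_right _)).add_right
      (Commute.one_right _)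
  have hsymm : (Lfam L0 L1 t * Pfam L0 L1 t).IsSymm := by
    rw [IsSymm, transpose_mul, (isSymm_Lfam h0 h1 t).eq, (isSymm_Pfam h0 h1 t).eq, hcomm.eq]
  refine eq_zero_of_isSymm_of_pow_eq_zero (k := m) hsymm ?_
  have e : Lfam L0 L1 t * Pfam L0 L1 t = Polynomial.aeval (Lfam L0 L1 t)
      ((Polynomial.X ^ 2 - Polynomial.C 3) * (Polynomial.X ^ 2 - Polynomial.C (1 / 3 : ℝ)) *
        Polynomial.X) := by
    have hp : (Polynomial.X ^ 2 - Polynomial.C 3) * (Polynomial.X ^ 2 - Polynomial.C (1 / 3 : ℝ)) *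
        Polynomial.X =
        Polynomial.X * (Polynomial.X ^ 4 - (10 / 3 : ℝ) • Polynomial.X ^ 2 + 1) := by
      have h3 : (Polynomial.C 3 * Polynomial.C (1 / 3) : Polynomial ℝ) = 1 := by
        rw [← Polynomial.C_mul]; norm_num
      have h10 : (Polynomial.C (10 / 3) : Polynomial ℝ) =
          Polynomial.C 3 + Polynomial.C (1 / 3) := by
        rw [← Polynomial.C_add]; norm_num
      rw [Polynomial.smul_eq_C_mul, h10]
      linear_combination Polynomial.X * h3
    rw [hp]
    simp [Pfam]
  rw [e, ← map_pow, mul_pow, mul_pow, ← hiso, aeval_self_charpoly]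

lemma Pfam_mulVec_of_mem_ker {t : ℝ} {v : Fin n → ℝ} (hv : Lfam L0 L1 t *ᵥ v = 0) :
    Pfam L0 L1 t *ᵥ v = v := by
  simp [Pfam, add_mulVec, sub_mulVec, smul_mulVec, pow_succ, ← mulVec_mulVec, hv]

lemma continuous_Pfam : Continuous (Pfam L0 L1) := by
  unfold Pfam Lfam
  fun_prop

lemma dense_sin_sub_ne_zero (s : ℝ) : Dense {r : ℝ | Real.sin (r - s) ≠ 0} := by
  have h : {r : ℝ | Real.sin (r - s) ≠ 0} = (Set.range fun k : ℤ => k * Real.pi + s)ᶜ := by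
    ext r
    simp [Real.sin_eq_zero_iff, eq_sub_iff_add_eq]
  rw [h]
  exact (Set.countable_range _).dense_compl ℝ

lemma dotProduct_mulVec_comm_of_isSymm {A : Matrix (Fin n) (Fin n) ℝ} (hA : A.IsSymm)
    (u v : Fin n → ℝ) : u ⬝ᵥ A *ᵥ v = (A *ᵥ u) ⬝ᵥ v := by
  rw [dotProduct_mulVec, ← mulVec_transpose, hA.eq]

/-- The kernels at two parameters spanning the pencil are orthogonal for every form of the
pencil. -/
lemma dotProduct_Lfam_of_sin_ne_zero (h0 : L0.IsSymm) (h1 : L1.IsSymm) {r s : ℝ}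
    (hrs : Real.sin (r - s) ≠ 0) {u v : Fin n → ℝ} (hu : Lfam L0 L1 s *ᵥ u = 0)
    (hv : Lfam L0 L1 r *ᵥ v = 0) (q : ℝ) : u ⬝ᵥ Lfam L0 L1 q *ᵥ v = 0 := by
  have a : u ⬝ᵥ Lfam L0 L1 s *ᵥ v = 0 := by
    rw [dotProduct_mulVec_comm_of_isSymm (isSymm_Lfam h0 h1 s), hu, zero_dotProduct]
  have b : u ⬝ᵥ Lfam L0 L1 r *ᵥ v = 0 := by rw [hv, dotProduct_zero]
  simp only [Lfam, add_mulVec, smul_mulVec, dotProduct_add, dotProduct_smul, smul_eq_mul]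
    at a b ⊢
  rw [Real.sin_sub] at hrs
  generalize u ⬝ᵥ L0 *ᵥ v = x at a b ⊢
  generalize u ⬝ᵥ L1 *ᵥ v = y at a b ⊢
  have hx : x = 0 := by
    apply (mul_eq_zero.1 (?_ : _ * x = 0)).resolve_left hrs
    linear_combination Real.sin r * a - Real.sin s * b
  have hy : y = 0 := by
    apply (mul_eq_zero.1 (?_ : _ * y = 0)).resolve_left hrs
    linear_combination Real.cos s * b - Real.cos r * a
  rw [hx, hy]; ring

/-- Any two kernels of the isospectral family are orthogonal for every form of the pencil. -/
lemma dotProduct_Lfam_of_mem_ker {m : ℕ} (h0 : L0.IsSymm) (h1 : L1.IsSymm)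
    (hiso : ∀ t : ℝ, (Lfam L0 L1 t).charpoly =
      (Polynomial.X ^ 2 - Polynomial.C 3) ^ m *
        (Polynomial.X ^ 2 - Polynomial.C (1 / 3 : ℝ)) ^ m * Polynomial.X ^ m)
    {s t : ℝ} {u v : Fin n → ℝ} (hu : Lfam L0 L1 s *ᵥ u = 0)
    (hv : Lfam L0 L1 t *ᵥ v = 0) (q : ℝ) : u ⬝ᵥ Lfam L0 L1 q *ᵥ v = 0 := by
  have hc : Continuous fun r => u ⬝ᵥ Lfam L0 L1 q *ᵥ (Pfam L0 L1 r *ᵥ v) := by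
    have := continuous_Pfam (L0 := L0) (L1 := L1)
    fun_prop
  have h := hc.ext_on (dense_sin_sub_ne_zero s) continuous_const
    (g := fun _ => (0 : ℝ)) fun r hr =>
      dotProduct_Lfam_of_sin_ne_zero h0 h1 hr hu (by
        rw [mulVec_mulVec, Lfam_mul_Pfam h0 h1 (hiso r), zero_mulVec]) q
  simpa [Pfam_mulVec_of_mem_ker hv] using congrFun h t

/-- The span of the kernels is totally isotropic for every form of the pencil. -/
lemma dotProduct_Lfam_of_mem_iSup_ker {m : ℕ} (h0 : L0.IsSymm) (h1 : L1.IsSymm)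
    (hiso : ∀ t : ℝ, (Lfam L0 L1 t).charpoly =
      (Polynomial.X ^ 2 - Polynomial.C 3) ^ m *
        (Polynomial.X ^ 2 - Polynomial.C (1 / 3 : ℝ)) ^ m * Polynomial.X ^ m)
    {u v : Fin n → ℝ}
    (hu : u ∈ ⨆ t : ℝ, LinearMap.ker (Lfam L0 L1 t).mulVecLin)
    (hv : v ∈ ⨆ t : ℝ, LinearMap.ker (Lfam L0 L1 t).mulVecLin) (q : ℝ) :
    u ⬝ᵥ Lfam L0 L1 q *ᵥ v = 0 := by
  induction hu using Submodule.iSup_induction' with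
  | zero => exact zero_dotProduct _
  | add x y _ _ hx hy => rw [add_dotProduct, hx, hy, add_zero]
  | mem s u hu =>
    induction hv using Submodule.iSup_induction' with
    | zero => rw [mulVec_zero, dotProduct_zero]
    | add x y _ _ hx hy => rw [mulVec_add, dotProduct_add, hx, hy, add_zero]
    | mem t v hv => exact dotProduct_Lfam_of_mem_ker h0 h1 hiso hu hv q

lemma finrank_ker_Lfam_le {m : ℕ}
    (hiso : ∀ t : ℝ, (Lfam L0 L1 t).charpoly =
      (Polynomial.X ^ 2 - Polynomial.C 3) ^ m *
        (Polynomial.X ^ 2 - Polynomial.C (1 / 3 : ℝ)) ^ m * Polynomial.X ^ m)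
    (t : ℝ) :
    Module.finrank ℝ (LinearMap.ker (Lfam L0 L1 t).mulVecLin) ≤ m := by
  have h := LinearMap.finrank_eigenspace_le (Lfam L0 L1 t).mulVecLin 0
  rw [Module.End.eigenspace_zero, charpoly_mulVecLin, hiso t] at h
  refine h.trans (le_of_eq ?_)
  have hroot : ∀ c : ℝ, c ≠ 0 →
      Polynomial.rootMultiplicity 0 ((Polynomial.X ^ 2 - Polynomial.C c) ^ m) = 0 := by
    intro c hc
    apply Polynomial.rootMultiplicity_eq_zero
    simp [hc]
  have hX := Polynomial.rootMultiplicity_X_sub_C_pow (0 : ℝ) m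
  rw [Polynomial.C_0, sub_zero] at hX
  have hmonic : ∀ c : ℝ, ((Polynomial.X ^ 2 - Polynomial.C c) ^ m).Monic := fun c =>
    (Polynomial.monic_X_pow_sub_C c two_ne_zero).pow m
  have h₁ := (hmonic 3).mul (hmonic (1 / 3))
  rw [Polynomial.rootMultiplicity_mul (h₁.mul (Polynomial.monic_X_pow m)).ne_zero,
    Polynomial.rootMultiplicity_mul h₁.ne_zero, hroot 3 (by norm_num),
    hroot (1 / 3) (by norm_num), hX, zero_add, zero_add]

/-- Twice the dimension of the span of the kernels is at most `n + m`. -/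
lemma two_mul_finrank_iSup_ker_le {m : ℕ} (h0 : L0.IsSymm) (h1 : L1.IsSymm)
    (hiso : ∀ t : ℝ, (Lfam L0 L1 t).charpoly =
      (Polynomial.X ^ 2 - Polynomial.C 3) ^ m *
        (Polynomial.X ^ 2 - Polynomial.C (1 / 3 : ℝ)) ^ m * Polynomial.X ^ m) :
    2 * Module.finrank ℝ (⨆ t : ℝ, LinearMap.ker (Lfam L0 L1 t).mulVecLin : Submodule ℝ _) ≤
      n + m := by
  set E : Submodule ℝ (Fin n → ℝ) := ⨆ t : ℝ, LinearMap.ker (Lfam L0 L1 t).mulVecLin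
  have hdisj : Disjoint E (E.map (Lfam L0 L1 0).mulVecLin) := by
    rw [Submodule.disjoint_def]
    rintro _ hu ⟨v, hv, rfl⟩
    exact dotProduct_self_eq_zero.1 (dotProduct_Lfam_of_mem_iSup_ker h0 h1 hiso hu hv 0)
  have hle := Submodule.finrank_add_finrank_le_of_disjoint hdisj
  have hrn := ((Lfam L0 L1 0).mulVecLin.domRestrict E).finrank_range_add_finrank_ker
  rw [LinearMap.range_domRestrict] at hrn
  have hker : Module.finrank ℝ (LinearMap.ker ((Lfam L0 L1 0).mulVecLin.domRestrict E)) ≤ m := by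
    rw [LinearMap.ker_domRestrict, ← Submodule.finrank_map_subtype_eq]
    exact (Submodule.finrank_mono (Submodule.map_comap_le _ _)).trans (finrank_ker_Lfam_le hiso 0)
  rw [Module.finrank_fin_fun] at hle
  omega

end Kernel

/-- if `L(t) = cos(t)·L0 + sin(t)·L1` is a family of real symmetric `5m × 5m`
matrices with spectrum `{-√3, -1/√3, 0, 1/√3, √3}`, each eigenvalue of multiplicity `m`,
for all `t`, then (a) the complex span of the union over `t` of the column spaces of `P(t)`
(regarded as complex matrices) equals the sum of the ranges of `P₄, P₂, P₀, P₋₂, P₋₄`, and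
(b) the real span `E` of the kernels `ker L(t)` has dimension at most `3m`. -/
theorem statement3 (m : ℕ) (hm : 0 < m)
    (L0 L1 : Matrix (Fin (5 * m)) (Fin (5 * m)) ℝ)
    (h0 : L0.IsSymm) (h1 : L1.IsSymm)
    (hiso : ∀ t : ℝ, (Lfam L0 L1 t).charpoly =
      (Polynomial.X ^ 2 - Polynomial.C 3) ^ m *
        (Polynomial.X ^ 2 - Polynomial.C (1 / 3 : ℝ)) ^ m * Polynomial.X ^ m) :
    (⨆ t : ℝ, LinearMap.range ((Pfam L0 L1 t).map Complex.ofReal).mulVecLin) =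
      LinearMap.range (Pfour L0 L1).mulVecLin ⊔ LinearMap.range (Ptwo L0 L1).mulVecLin ⊔
        LinearMap.range (Pzero L0 L1).mulVecLin ⊔ LinearMap.range (Pmtwo L0 L1).mulVecLin ⊔
        LinearMap.range (Pmfour L0 L1).mulVecLin ∧
    Module.finrank ℝ (⨆ t : ℝ, LinearMap.ker (Lfam L0 L1 t).mulVecLin : Submodule ℝ _) ≤
      3 * m := by
  refine ⟨iSup_range_Pfam L0 L1, ?_⟩
  have h := two_mul_finrank_iSup_ker_le h0 h1 hiso
  omega

end
end

section
/- Let A be a complex d×d matrix with A^T = A and A² = 0. Then there exist a nonnegative integer d₀ with 2d₀ ≤ d, a real orthogonal d×d matrix U, and a real diagonal positive definite d₀×d₀ matrix A₀ (or d₀ = 0), such that U·A·U^T is the block matrix whose upper-left (2d₀)×(2d₀) block equals σ ⊗ A₀ and whose remaining entries are zero. -/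
open Matrix Kronecker

noncomputable section

/-- The isotropic vector `e₊ = (e₁ + i·e₂)/√2` of `ℂ²`, as a `2 × 1` column matrix. -/
def ePlus : Matrix (Fin 2) (Fin 1) ℂ :=
  !![1 / (Real.sqrt 2 : ℂ); Complex.I / (Real.sqrt 2 : ℂ)]

/-- `σ = e₊·e₊ᵀ = ½·[[1, i], [i, -1]] ∈ M₂(ℂ)`. -/
def sigmaC : Matrix (Fin 2) (Fin 2) ℂ := ePlus * ePlusᵀ

/-- The Kronecker product, with indices flattened via `finProdFinEquiv`. -/
def kflat {a b p q : ℕ} (A : Matrix (Fin a) (Fin b) ℂ) (B : Matrix (Fin p) (Fin q) ℂ) :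
    Matrix (Fin (a * p)) (Fin (b * q)) ℂ :=
  Matrix.reindex finProdFinEquiv finProdFinEquiv (A ⊗ₖ B)

section SymmetricPair

variable {E : Type*} [NormedAddCommGroup E] [InnerProductSpace ℝ E]
  {X Y : E →ₗ[ℝ] E}

open Module

/-- If `w` is orthogonal to the eigenvectors of `X` with positive eigenvalue and so is `Y w`,
where `X` and `Y` anticommute and have equal squares, then both kill `w`. -/
theorem apply_eq_zero_of_orthogonal_pos {ι : Type*} [Fintype ι]
    (hX : X.IsSymmetric) (hY : Y.IsSymmetric)
    (hsq : ∀ x, X (X x) = Y (Y x)) (hanti : ∀ x, X (Y x) = -Y (X x))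
    (b : OrthonormalBasis ι ℝ E) (l : ι → ℝ) (hb : ∀ i, X (b i) = l i • b i) (w : E)
    (hw : ∀ i, 0 < l i → inner ℝ w (b i) = 0)
    (hYw : ∀ i, 0 < l i → inner ℝ (Y w) (b i) = 0) : X w = 0 ∧ Y w = 0 := by
  have key : ∀ k, l k < 0 → inner ℝ w (b k) = 0 := by
    intro k hk
    have h1 : inner ℝ (Y w) (Y (b k)) = 0 := by
      rw [← b.sum_inner_mul_inner]
      refine Finset.sum_eq_zero fun i _ => ?_
      by_cases hi : 0 < l i
      · rw [hYw i hi, zero_mul]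
      · have h2 : l i * inner ℝ (b i) (Y (b k)) = -l k * inner ℝ (b i) (Y (b k)) := by
          have h := hX (b i) (Y (b k))
          rw [hanti, hb, hb, map_smul, inner_neg_right, real_inner_smul_left,
            real_inner_smul_right] at h
          rw [h, neg_mul]
        have h3 : (l i + l k) * inner ℝ (b i) (Y (b k)) = 0 := by linarith
        rcases mul_eq_zero.mp h3 with h | h
        · linarith
        · rw [h, mul_zero]
    rw [hY, ← hsq, hb, map_smul, hb, real_inner_smul_right, real_inner_smul_right] at h1
    have := hk.ne
    simp_all
  have hXw : X w = 0 := by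
    refine InnerProductSpace.ext_inner_right_basis b.toBasis fun i => ?_
    rw [b.coe_toBasis, hX, hb, real_inner_smul_right, inner_zero_left]
    rcases lt_trichotomy (l i) 0 with h | h | h
    · rw [key i h, mul_zero]
    · rw [h, zero_mul]
    · rw [hw i h, mul_zero]
  refine ⟨hXw, ?_⟩
  rw [← inner_self_eq_zero (𝕜 := ℝ), hY, ← hsq, hXw, map_zero, inner_zero_right]

/-- Normal form of a pair of anticommuting symmetric operators with equal squares. -/
theorem exists_orthonormalBasis_of_anticommute [FiniteDimensional ℝ E] {n : ℕ}
    (hn : finrank ℝ E = n)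
    (hX : X.IsSymmetric) (hY : Y.IsSymmetric)
    (hsq : ∀ x, X (X x) = Y (Y x)) (hanti : ∀ x, X (Y x) = -Y (X x)) :
    ∃ (r : ℕ) (_ : 2 * r ≤ n)
      (b : OrthonormalBasis ((Fin 2 × Fin r) ⊕ Fin (n - 2 * r)) ℝ E)
      (m : Fin r → ℝ), (∀ j, 0 < m j) ∧
      (∀ j, X (b (.inl (0, j))) = m j • b (.inl (0, j))) ∧
      (∀ j, X (b (.inl (1, j))) = -m j • b (.inl (1, j))) ∧
      (∀ j, Y (b (.inl (0, j))) = m j • b (.inl (1, j))) ∧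
      (∀ j, Y (b (.inl (1, j))) = m j • b (.inl (0, j))) ∧
      (∀ k, X (b (.inr k)) = 0) ∧ ∀ k, Y (b (.inr k)) = 0 := by
  classical
  let a := hX.eigenvectorBasis hn
  let l := hX.eigenvalues hn
  have ha : ∀ i, X (a i) = l i • a i := fun i => hX.apply_eigenvectorBasis hn i
  let e := Fintype.equivFin {i // 0 < l i}
  set r := Fintype.card {i // 0 < l i}
  let f : Fin r → Fin n := fun j => (e.symm j).1
  have hf : Function.Injective f := Subtype.val_injective.comp e.symm.injective
  have hpos : ∀ j, 0 < l (f j) := fun j => (e.symm j).2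
  have hsurj : ∀ i, 0 < l i → ∃ j, f j = i := fun i hi => ⟨e ⟨i, hi⟩, by simp [f]⟩
  let u : Fin 2 × Fin r → E := fun p =>
    if p.1 = 0 then a (f p.2) else (l (f p.2))⁻¹ • Y (a (f p.2))
  have hu0 : ∀ j, u (0, j) = a (f j) := fun j => rfl
  have hu1 : ∀ j, u (1, j) = (l (f j))⁻¹ • Y (a (f j)) := fun j => rfl
  have X0 : ∀ j, X (u (0, j)) = l (f j) • u (0, j) := fun j => ha _
  have Y0 : ∀ j, Y (u (0, j)) = l (f j) • u (1, j) := fun j => by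
    rw [hu0, hu1, smul_inv_smul₀ (hpos j).ne']
  have X1 : ∀ j, X (u (1, j)) = -l (f j) • u (1, j) := fun j => by
    rw [hu1, map_smul, hanti, ha, map_smul, neg_smul, smul_neg, smul_comm]
  have Y1 : ∀ j, Y (u (1, j)) = l (f j) • u (0, j) := fun j => by
    rw [hu1, map_smul, ← hsq, ha, map_smul, ha, inv_smul_smul₀ (hpos j).ne', hu0]
  have o00 : ∀ j k, inner ℝ (u (0, j)) (u (0, k)) = if j = k then 1 else 0 := fun j k => by
    rw [hu0, hu0, orthonormal_iff_ite.mp a.orthonormal]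
    simp [hf.eq_iff]
  have o01 : ∀ j k, inner ℝ (u (0, j)) (u (1, k)) = 0 := fun j k => by
    have h := hX (u (0, j)) (u (1, k))
    rw [X0, X1, real_inner_smul_left, real_inner_smul_right] at h
    have h3 : (l (f j) + l (f k)) * inner ℝ (u (0, j)) (u (1, k)) = 0 := by linarith
    exact (mul_eq_zero.mp h3).resolve_left (add_pos (hpos j) (hpos k)).ne'
  have o11 : ∀ j k, inner ℝ (u (1, j)) (u (1, k)) = if j = k then 1 else 0 := fun j k => by
    have h := hY (u (0, j)) (u (1, k))
    rw [Y0, Y1, real_inner_smul_left, real_inner_smul_right, o00] at h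
    have := (hpos j).ne'
    by_cases hjk : j = k
    · subst hjk
      simpa [this] using h
    · simpa [this, hjk] using h
  have hu : Orthonormal ℝ u := by
    rw [orthonormal_iff_ite]
    rintro ⟨s, j⟩ ⟨t, k⟩
    fin_cases s <;> fin_cases t <;> simp [o00, o01, o11]
    rw [real_inner_comm, o01]
  have hr : 2 * r ≤ n := by
    simpa [hn] using hu.linearIndependent.fintype_card_le_finrank
  let v : (Fin 2 × Fin r) ⊕ Fin (n - 2 * r) → E := Sum.elim u 0
  have hv : Orthonormal ℝ ((Set.range Sum.inl).domRestrict v) := by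
    rw [orthonormal_iff_ite] at hu ⊢
    rintro ⟨_, p, rfl⟩ ⟨_, q, rfl⟩
    simpa [v, Set.domRestrict, Subtype.ext_iff] using hu p q
  obtain ⟨b, hb⟩ := hv.exists_orthonormalBasis_extension_of_card_eq
    (by simp [hn]; omega)
  have hbu : ∀ p, b (.inl p) = u p := fun p => hb _ ⟨p, rfl⟩
  have hker : ∀ k, X (b (.inr k)) = 0 ∧ Y (b (.inr k)) = 0 := fun k => by
    have horth : ∀ p, inner ℝ (b (.inr k)) (u p) = 0 := fun p => by
      rw [← hbu, orthonormal_iff_ite.mp b.orthonormal, if_neg Sum.inr_ne_inl]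
    refine apply_eq_zero_of_orthogonal_pos hX hY hsq hanti a l ha _ (fun i hi => ?_)
      fun i hi => ?_
    · obtain ⟨j, rfl⟩ := hsurj i hi
      exact horth (0, j)
    · obtain ⟨j, rfl⟩ := hsurj i hi
      rw [hY, ← hu0, Y0, real_inner_smul_right, horth, mul_zero]
  refine ⟨r, hr, b, fun j => l (f j), hpos, ?_, ?_, ?_, ?_, fun k => (hker k).1,
    fun k => (hker k).2⟩ <;> intro j <;> simp only [hbu, X0, X1, Y0, Y1]

end SymmetricPair

theorem sigmaC_eq : sigmaC = !![1 / 2, Complex.I / 2; Complex.I / 2, -1 / 2] := by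
  have h : (Real.sqrt 2 : ℂ) * Real.sqrt 2 = 2 := by
    rw [← Complex.ofReal_mul, Real.mul_self_sqrt zero_le_two, Complex.ofReal_ofNat]
  have h2 : (Real.sqrt 2 : ℂ) ≠ 0 := fun h0 => by simp [h0] at h
  ext i j
  fin_cases i <;> fin_cases j <;> simp [sigmaC, ePlus, Matrix.mul_apply] <;> field_simp <;>
    simp [pow_two, h]

/-- Entries of `U * X * Uᵀ` as inner products of the rows of `U`. -/
theorem of_mul_mul_transpose_apply {n ι : Type*} [Fintype n] [DecidableEq n]
    (v : ι → EuclideanSpace ℝ n) (X : Matrix n n ℝ) (p q : ι) :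
    ((Matrix.of fun p i => v p i) * X * (Matrix.of fun p i => v p i)ᵀ) p q =
      inner ℝ (v p) (Matrix.toEuclideanLin X (v q)) := by
  rw [EuclideanSpace.inner_eq_star_dotProduct, Matrix.mul_assoc, Matrix.mul_apply_eq_vecMul,
    dotProduct_comm]
  simp [Matrix.vecMul, Matrix.mul_apply, dotProduct, Matrix.mulVec]

/-- any complex symmetric matrix `A` with `A² = 0` can be brought, by
conjugation with a real orthogonal matrix `U`, to the block form whose upper-left
`(2d₀) × (2d₀)` block is `σ ⊗ A₀` with `A₀` real diagonal positive definite (or `d₀ = 0`)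
and whose remaining entries vanish. -/
theorem statement7 (d : ℕ) (A : Matrix (Fin d) (Fin d) ℂ)
    (hsymm : Aᵀ = A) (hsq : A * A = 0) :
    ∃ (d₀ : ℕ) (h : 2 * d₀ ≤ d) (U : Matrix (Fin d) (Fin d) ℝ)
      (A₀ : Matrix (Fin d₀) (Fin d₀) ℝ),
      U * Uᵀ = 1 ∧ A₀.IsDiag ∧ (∀ i, 0 < A₀ i i) ∧
      U.map Complex.ofReal * A * (U.map Complex.ofReal)ᵀ =
        Matrix.reindex (finSumFinEquiv.trans (finCongr (by omega)))
          (finSumFinEquiv.trans (finCongr (by omega)))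
          (Matrix.fromBlocks (kflat sigmaC (A₀.map Complex.ofReal)) 0 0
            (0 : Matrix (Fin (d - 2 * d₀)) (Fin (d - 2 * d₀)) ℂ)) := by
  classical
  let X : Matrix (Fin d) (Fin d) ℝ := A.map Complex.re
  let Y : Matrix (Fin d) (Fin d) ℝ := A.map Complex.im
  have hA : A = X.map Complex.ofReal + Complex.I • Y.map Complex.ofReal := by
    ext i j
    simp [X, Y, mul_comm Complex.I]
  have hXs : Xᵀ = X := by rw [← Matrix.transpose_map, hsymm]
  have hYs : Yᵀ = Y := by rw [← Matrix.transpose_map, hsymm]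
  have hXY : X * X = Y * Y := by
    ext i j
    have h := congrArg Complex.re (congrFun (congrFun hsq i) j)
    simp only [Matrix.mul_apply, Complex.re_sum, Complex.mul_re, Finset.sum_sub_distrib,
      Matrix.zero_apply, Complex.zero_re] at h
    simpa [Matrix.mul_apply, X, Y] using sub_eq_zero.mp h
  have hanti : X * Y = -(Y * X) := by
    ext i j
    have h := congrArg Complex.im (congrFun (congrFun hsq i) j)
    simp only [Matrix.mul_apply, Complex.im_sum, Complex.mul_im, Finset.sum_add_distrib,
      Matrix.zero_apply, Complex.zero_im] at h
    simpa [Matrix.mul_apply, X, Y] using eq_neg_of_add_eq_zero_left h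
  obtain ⟨r, hr, b, m, hm, X0, X1, Y0, Y1, Xk, Yk⟩ :=
    exists_orthonormalBasis_of_anticommute (X := Matrix.toEuclideanLin X)
      (Y := Matrix.toEuclideanLin Y) (finrank_euclideanSpace_fin (𝕜 := ℝ) (n := d))
      (Matrix.isSymmetric_toEuclideanLin_iff.mpr (by simpa [Matrix.IsHermitian] using hXs))
      (Matrix.isSymmetric_toEuclideanLin_iff.mpr (by simpa [Matrix.IsHermitian] using hYs))
      (fun x => by simp [Matrix.toLpLin_apply, hXY])
      (fun x => by simp [Matrix.toLpLin_apply, hanti, Matrix.neg_mulVec])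
  let e : (Fin (2 * r) ⊕ Fin (d - 2 * r)) ≃ Fin d :=
    finSumFinEquiv.trans (finCongr (by omega))
  let g : Fin d → (Fin 2 × Fin r) ⊕ Fin (d - 2 * r) := fun p =>
    Sum.map finProdFinEquiv.symm id (e.symm p)
  have hg : Function.Injective g :=
    (finProdFinEquiv.symm.injective.sumMap Function.injective_id).comp e.symm.injective
  let U : Matrix (Fin d) (Fin d) ℝ := Matrix.of fun p i => b (g p) i
  have hU : ∀ Z p q, (U * Z * Uᵀ) p q = inner ℝ (b (g p)) (Matrix.toEuclideanLin Z (b (g q))) :=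
    of_mul_mul_transpose_apply fun p => b (g p)
  have hb := orthonormal_iff_ite.mp b.orthonormal
  refine ⟨r, hr, U, Matrix.diagonal fun j => 2 * m j, ?_, Matrix.isDiag_diagonal _,
    fun j => by simpa using hm j, ?_⟩
  · ext p q
    have h := hU 1 p q
    rw [Matrix.mul_one] at h
    rw [h]
    simp [hb, hg.eq_iff, Matrix.one_apply]
  have hUA : U.map Complex.ofReal * A * (U.map Complex.ofReal)ᵀ =
      (U * X * Uᵀ).map Complex.ofReal + Complex.I • (U * Y * Uᵀ).map Complex.ofReal := by
    have hmul : ∀ M N : Matrix (Fin d) (Fin d) ℝ, (M * N).map Complex.ofReal =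
        M.map Complex.ofReal * N.map Complex.ofReal :=
      fun M N => Matrix.map_mul (f := Complex.ofRealHom)
    rw [hA, hmul, hmul, hmul, hmul, Matrix.mul_add, Matrix.add_mul, Matrix.mul_smul,
      Matrix.smul_mul, Matrix.transpose_map]
  rw [hUA]
  ext p q
  rw [Matrix.add_apply, Matrix.smul_apply, Matrix.map_apply, Matrix.map_apply, hU, hU,
    Matrix.reindex_apply, Matrix.submatrix_apply]
  change _ = Matrix.fromBlocks _ _ _ _ (e.symm p) (e.symm q)
  simp only [g]
  rcases e.symm p with s | s <;> rcases e.symm q with t | t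
  · obtain ⟨⟨s, j⟩, rfl⟩ := finProdFinEquiv.surjective s
    obtain ⟨⟨t, k⟩, rfl⟩ := finProdFinEquiv.surjective t
    simp only [Sum.map_inl, Equiv.symm_apply_apply, Matrix.fromBlocks_apply₁₁, kflat,
      Matrix.reindex_apply, Matrix.submatrix_apply, Matrix.kroneckerMap_apply, sigmaC_eq,
      Matrix.map_apply, Matrix.diagonal_apply]
    by_cases hjk : j = k
    · subst hjk
      fin_cases s <;> fin_cases t <;>
        simp [X0, X1, Y0, Y1, real_inner_smul_right, hb] <;> ring
    · fin_cases s <;> fin_cases t <;>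
        simp [X0, X1, Y0, Y1, real_inner_smul_right, hb, hjk]
  · simp [Xk, Yk]
  · obtain ⟨⟨t, k⟩, rfl⟩ := finProdFinEquiv.surjective t
    fin_cases t <;> simp [X0, X1, Y0, Y1, real_inner_smul_right, hb]
  · simp [Xk, Yk]

end
end

section
/- Let A = σ ⊗ A₀ be a (2n₁)×(2n₁) complex matrix and B = σ ⊗ B₀ a (2n₂)×(2n₂) complex matrix, where A₀ is a real diagonal positive definite n₁×n₁ matrix and B₀ is a real diagonal positive definite n₂×n₂ matrix. Then: (1) if C is a complex n₃×(2n₁) matrix with C·A = 0, then C = e_+^T ⊗ C₀ for some complex n₃×n₁ matrix C₀; (2) if C is a complex (2n₂)×n₄ matrix with B·C = 0, then C = e_+ ⊗ C₀ for some complex n₂×n₄ matrix C₀; (3) if C is a complex (2n₂)×(2n₁) matrix with C·A = 0 and B·C = 0, then C = σ ⊗ C₀ for some complex n₂×n₁ matrix C₀. -/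
open Matrix Kronecker

noncomputable section

/-- The canonical identification `Fin 1 × Fin k ≃ Fin k`. -/
def oneProd (k : ℕ) : Fin 1 × Fin k ≃ Fin k := Equiv.uniqueProd (Fin k) (Fin 1)

theorem sigmaC_transpose : sigmaCᵀ = sigmaC := by
  simp [sigmaC, Matrix.transpose_mul]

/-- If `C * (σ ⊗ A) = 0` with `A` a positive definite diagonal matrix, the second block column of `C`
is `i` times the first one. -/
theorem apply_one_of_mul_sigmaC_kronecker_eq_zero {m n : Type*} [Fintype n]
    {A : Matrix n n ℝ} (hA : A.IsDiag) (hA0 : ∀ i, 0 < A i i) {C : Matrix m (Fin 2 × n) ℂ}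
    (h : C * (sigmaC ⊗ₖ A.map Complex.ofReal) = 0) (k : m) (j : n) :
    C k (1, j) = Complex.I * C k (0, j) := by
  have hs : ∀ b, ∑ i, C k (b, i) * (sigmaC b 0 * (A i j : ℂ)) =
      C k (b, j) * (sigmaC b 0 * (A j j : ℂ)) := fun b =>
    Fintype.sum_eq_single j fun i hij => by simp [hA hij]
  have hk := congrFun (congrFun h k) (0, j)
  simp only [Matrix.mul_apply, Matrix.kroneckerMap_apply, Matrix.map_apply,
    Fintype.sum_prod_type, hs, Fin.sum_univ_two, Matrix.zero_apply] at hk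
  have hj : (A j j : ℂ) ≠ 0 := Complex.ofReal_ne_zero.mpr (hA0 j).ne'
  simp only [sigmaC_eq, Matrix.of_apply, Matrix.cons_val_zero, Matrix.cons_val_one] at hk
  have hc : C k (0, j) + Complex.I * C k (1, j) = 0 :=
    mul_left_cancel₀ hj (by linear_combination 2 * hk)
  linear_combination (-Complex.I) * hc + C k (1, j) * Complex.I_mul_I

/-- If `(σ ⊗ B) * C = 0` with `B` a positive definite diagonal matrix, the second block row of `C`
is `i` times the first one. -/
theorem one_apply_of_sigmaC_kronecker_mul_eq_zero {m n : Type*} [Fintype n]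
    {B : Matrix n n ℝ} (hB : B.IsDiag) (hB0 : ∀ i, 0 < B i i) {C : Matrix (Fin 2 × n) m ℂ}
    (h : (sigmaC ⊗ₖ B.map Complex.ofReal) * C = 0) (j : n) (k : m) :
    C (1, j) k = Complex.I * C (0, j) k := by
  refine apply_one_of_mul_sigmaC_kronecker_eq_zero (C := Cᵀ) hB.transpose hB0 ?_ k j
  rw [Matrix.transpose_map]
  nth_rewrite 1 [← sigmaC_transpose]
  rw [Matrix.kroneckerMap_transpose, ← Matrix.transpose_mul, h, Matrix.transpose_zero]

/-- let `A = σ ⊗ A₀` and `B = σ ⊗ B₀` with `A₀, B₀` real diagonal positive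
definite (of sizes `n₁`, `n₂`); `ℂ^{2n}` is identified with `ℂ² ⊗ ℂⁿ`. Then
(1) `C·A = 0` forces `C = e₊ᵀ ⊗ C₀`; (2) `B·C = 0` forces `C = e₊ ⊗ C₀`;
(3) `C·A = 0` and `B·C = 0` force `C = σ ⊗ C₀`. -/
theorem statement8 (n₁ n₂ : ℕ)
    (A₀ : Matrix (Fin n₁) (Fin n₁) ℝ) (B₀ : Matrix (Fin n₂) (Fin n₂) ℝ)
    (hA₀ : A₀.IsDiag) (hA₀pos : ∀ i, 0 < A₀ i i)
    (hB₀ : B₀.IsDiag) (hB₀pos : ∀ i, 0 < B₀ i i) :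
    (∀ (n₃ : ℕ) (C : Matrix (Fin n₃) (Fin 2 × Fin n₁) ℂ),
      C * (sigmaC ⊗ₖ A₀.map Complex.ofReal) = 0 →
      ∃ C₀ : Matrix (Fin n₃) (Fin n₁) ℂ,
        C = Matrix.reindex (oneProd n₃) (Equiv.refl (Fin 2 × Fin n₁)) (ePlusᵀ ⊗ₖ C₀)) ∧
    (∀ (n₄ : ℕ) (C : Matrix (Fin 2 × Fin n₂) (Fin n₄) ℂ),
      (sigmaC ⊗ₖ B₀.map Complex.ofReal) * C = 0 →
      ∃ C₀ : Matrix (Fin n₂) (Fin n₄) ℂ,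
        C = Matrix.reindex (Equiv.refl (Fin 2 × Fin n₂)) (oneProd n₄) (ePlus ⊗ₖ C₀)) ∧
    (∀ C : Matrix (Fin 2 × Fin n₂) (Fin 2 × Fin n₁) ℂ,
      C * (sigmaC ⊗ₖ A₀.map Complex.ofReal) = 0 →
      (sigmaC ⊗ₖ B₀.map Complex.ofReal) * C = 0 →
      ∃ C₀ : Matrix (Fin n₂) (Fin n₁) ℂ, C = sigmaC ⊗ₖ C₀) := by
  have h2 : (Real.sqrt 2 : ℂ) ≠ 0 := by simp
  refine ⟨fun n₃ C h => ?_, fun n₄ C h => ?_, fun C hA hB => ?_⟩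
  · refine ⟨Matrix.of fun k j => Real.sqrt 2 * C k (0, j), ?_⟩
    ext k ⟨a, j⟩
    have hk := apply_one_of_mul_sigmaC_kronecker_eq_zero hA₀ hA₀pos h k j
    fin_cases a
    · simp [ePlus, oneProd, h2]
    · simp [ePlus, oneProd, hk]
      field_simp
  · refine ⟨Matrix.of fun j k => Real.sqrt 2 * C (0, j) k, ?_⟩
    ext ⟨a, j⟩ k
    have hk := one_apply_of_sigmaC_kronecker_mul_eq_zero hB₀ hB₀pos h j k
    fin_cases a
    · simp [ePlus, oneProd, h2]
    · simp [ePlus, oneProd, hk]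
      field_simp
  · refine ⟨Matrix.of fun i j => 2 * C (0, i) (0, j), ?_⟩
    ext ⟨a, i⟩ ⟨b, j⟩
    have hr := apply_one_of_mul_sigmaC_kronecker_eq_zero hA₀ hA₀pos hA
    have hl := one_apply_of_sigmaC_kronecker_mul_eq_zero hB₀ hB₀pos hB
    fin_cases a <;> fin_cases b <;> simp [sigmaC_eq, hr, hl] <;> ring_nf
    simp

end
end
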